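/- arXiv:1401.5123 — 2 statements merged into one kernel-verified Lean document; each statement's English description precedes it below -/
import Mathlib

section
/- Let d ≥ 2 and σ_d(x) = d·x on ℝ/ℤ. If a, b ∈ ℝ/ℤ are both periodic points of σ_d and the chord ab is a leaf of a sibling σ_d-invariant geolamination Λ, then a and b have the same period: the least n with σ_d^n(a)=a equals the least m with σ_d^m(b)=b. -/
open Function

noncomputable section

/-- The circle ℝ/ℤ. -/
abbrev S1 := AddCircle (1 : ℝ)

/-- σ_d : multiplication by d on ℝ/ℤ. -/
def sig (d : ℕ) : S1 → S1 := fun x => d • x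

/-- Two chords of the closed unit disk, with endpoint pairs {a,b} and {c,e}, are linked
(cross in the open unit disk) iff the pairs strictly separate each other on the circle. -/
def Linked (a b c e : S1) : Prop :=
  (sbtw a c b ∧ sbtw b e a) ∨ (sbtw a e b ∧ sbtw b c a)


/-- A sibling σ_d-invariant geolamination: a closed family of pairwise unlinked chords
(encoded as ordered pairs, symmetric) containing all degenerate chords, closed under
taking images, having preimage leaves, and with d pairwise disjoint siblings for each
leaf with nondegenerate image. -/
structure Geolam (d : ℕ) where
  leaves : Set (S1 × S1)
  symm : ∀ a b : S1, (a, b) ∈ leaves → (b, a) ∈ leaves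
  degenerate_mem : ∀ x : S1, (x, x) ∈ leaves
  pairwise_unlinked : ∀ p ∈ leaves, ∀ q ∈ leaves, ¬ Linked p.1 p.2 q.1 q.2
  closed : IsClosed leaves
  forward : ∀ p ∈ leaves, (sig d p.1, sig d p.2) ∈ leaves
  pullback : ∀ p ∈ leaves, ∃ q ∈ leaves, (sig d q.1, sig d q.2) = p
  siblings : ∀ p ∈ leaves, sig d p.1 ≠ sig d p.2 →
    ∃ s : Fin d → S1 × S1, (∃ i, s i = p) ∧
      (∀ i, s i ∈ leaves ∧ sig d (s i).1 = sig d p.1 ∧ sig d (s i).2 = sig d p.2) ∧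
      ∀ i j, i ≠ j → ({(s i).1, (s i).2} : Set S1) ∩ {(s j).1, (s j).2} = ∅


/-- representative in [0,1) -/
def rr (x : S1) : ℝ := (AddCircle.equivIco (1:ℝ) 0 x : ℝ)

lemma rr_coe (t : ℝ) : rr (t : S1) = Int.fract t := by
  unfold rr
  rw [AddCircle.coe_equivIco_mk_apply]; simp

lemma coe_rr (x : S1) : ((rr x : ℝ) : S1) = x := by
  unfold rr
  exact (AddCircle.equivIco (1:ℝ) 0).symm_apply_apply x

lemma rr_nonneg (x : S1) : 0 ≤ rr x := by
  rw [← coe_rr x, rr_coe]; exact Int.fract_nonneg _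

lemma rr_lt (x : S1) : rr x < 1 := by
  rw [← coe_rr x, rr_coe]; exact Int.fract_lt_one _

lemma rr_inj {x y : S1} (h : rr x = rr y) : x = y := by
  rw [← coe_rr x, h, coe_rr]

lemma rr_zero : rr 0 = 0 := by
  have := rr_coe 0
  simpa using this

lemma rr_sub_inj {x y a : S1} (h : rr (x - a) = rr (y - a)) : x = y := by
  simpa using rr_inj h

lemma rr_sig (d : ℕ) (x y : S1) : rr (sig d x - sig d y) = Int.fract (d * rr (x - y)) := by
  unfold sig
  rw [← smul_sub, ← rr_coe]
  congr 1
  conv_lhs => rw [← coe_rr (x - y)]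
  rw [← AddCircle.coe_nsmul, nsmul_eq_mul]

lemma sbtw_of (a c b : S1) (h0 : 0 < rr (c - a)) (h1 : rr (c - a) < rr (b - a)) : sbtw a c b := by
  rw [sbtw_iff_not_btw]
  intro h
  have h2 : btw a b c := by first | exact btw_cyclic_left h | exact btw_cyclic_right h | exact btw_cyclic_left (btw_cyclic_left h)
  have ea : ((rr a : ℝ) : S1) = a := coe_rr a
  have eb : ((rr a + rr (b - a) : ℝ) : S1) = b := by
    rw [AddCircle.coe_add, coe_rr, coe_rr]; abel
  have ec : ((rr a + rr (c - a) : ℝ) : S1) = c := by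
    rw [AddCircle.coe_add, coe_rr, coe_rr]; abel
  have hb1 := rr_lt (b - a)
  rw [← ea, ← eb, ← ec] at h2
  have h3 := QuotientAddGroup.btw_coe_iff.1 h2
  rw [(toIcoMod_eq_self _).2 ⟨by linarith, by linarith⟩,
    (toIocMod_eq_self _).2 ⟨by linarith, by linarith⟩] at h3
  linarith

lemma key (d : ℕ) (hd : 2 ≤ d) (Λ : Geolam d) (a b c : S1)
    (hab : (a, b) ∈ Λ.leaves) (hac : (a, c) ∈ Λ.leaves)
    (h1 : sig d a ≠ sig d b) (h2 : sig d a ≠ sig d c) (h3 : sig d b ≠ sig d c)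
    (hlt : rr (c - a) < rr (b - a)) :
    rr (sig d c - sig d a) < rr (sig d b - sig d a) := by
  by_contra hcon
  have hd0 : (0:ℝ) < d := by positivity
  have hle : rr (sig d b - sig d a) < rr (sig d c - sig d a) :=
    lt_of_le_of_ne (not_lt.1 hcon) (fun h => h3 (rr_sub_inj h))
  have hbpos : 0 < rr (sig d b - sig d a) := by
    refine lt_of_le_of_ne (rr_nonneg _) (fun h => h1 ?_)
    rw [← rr_zero] at h
    exact (sub_eq_zero.1 (rr_inj h).symm).symm
  obtain ⟨s, ⟨i0, hi0⟩, hs, hdis⟩ := Λ.siblings (a, c) hac h2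
  simp only at hs
  obtain ⟨N, hN⟩ : ∃ N : ℕ, (d:ℝ) * rr (b - a) = N + rr (sig d b - sig d a) := by
    refine ⟨⌊(d:ℝ) * rr (b - a)⌋₊, ?_⟩
    rw [rr_sig, natCast_floor_eq_intCast_floor (mul_nonneg hd0.le (rr_nonneg _))]
    exact (Int.floor_add_fract _).symm
  have hk : ∀ i, ∃ k : Fin d, (d:ℝ) * rr ((s i).1 - a) = (k : ℕ) := by
    intro i
    have e := rr_sig d (s i).1 a
    rw [(hs i).2.1, sub_self, rr_zero] at e
    have e2 : (d:ℝ) * rr ((s i).1 - a) = (⌊(d:ℝ) * rr ((s i).1 - a)⌋₊ : ℕ) := by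
      rw [natCast_floor_eq_intCast_floor (mul_nonneg hd0.le (rr_nonneg _))]
      have := Int.floor_add_fract ((d:ℝ) * rr ((s i).1 - a))
      linarith
    refine ⟨⟨⌊(d:ℝ) * rr ((s i).1 - a)⌋₊, ?_⟩, e2⟩
    have : (d:ℝ) * rr ((s i).1 - a) < d := by nlinarith [rr_lt ((s i).1 - a)]
    rw [e2] at this
    exact_mod_cast this
  choose κ hκ using hk
  have hdis1 : ∀ i j, (s i).1 = (s j).1 → i = j := by
    intro i j h
    by_contra hne
    have : (s i).1 ∈ ({(s i).1, (s i).2} : Set S1) ∩ {(s j).1, (s j).2} := ⟨by simp, by simp [h]⟩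
    rw [hdis i j hne] at this
    exact this
  have hdis2 : ∀ i j, (s i).2 = (s j).2 → i = j := by
    intro i j h
    by_contra hne
    have : (s i).2 ∈ ({(s i).1, (s i).2} : Set S1) ∩ {(s j).1, (s j).2} := ⟨by simp, by simp [h]⟩
    rw [hdis i j hne] at this
    exact this
  have κinj : Function.Injective κ := by
    intro i j h
    apply hdis1
    apply rr_sub_inj (a := a)
    have e1 := hκ i
    rw [h, ← hκ j] at e1
    exact mul_left_cancel₀ hd0.ne' e1
  have κsurj := Finite.surjective_of_injective κinj
  have hNd : N < d := by
    have : (d:ℝ) * rr (b - a) < d := by nlinarith [rr_lt (b - a)]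
    have : (N:ℝ) < d := by linarith
    exact_mod_cast this
  have hl : ∀ i, ∃ l : ℕ, (d:ℝ) * rr ((s i).2 - a) = l + rr (sig d c - sig d a) := by
    intro i
    refine ⟨⌊(d:ℝ) * rr ((s i).2 - a)⌋₊, ?_⟩
    rw [← (hs i).2.2, rr_sig, natCast_floor_eq_intCast_floor (mul_nonneg hd0.le (rr_nonneg _))]
    exact (Int.floor_add_fract _).symm
  choose l hl using hl
  have linj : Function.Injective l := by
    intro i j h
    apply hdis2
    apply rr_sub_inj (a := a)
    have e1 := hl i
    rw [h, ← hl j] at e1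
    exact mul_left_cancel₀ hd0.ne' e1
  have hin : ∀ i, (κ i : ℕ) ≤ N → l i < N := by
    intro i hi
    have hi' : ((κ i : ℕ) : ℝ) ≤ N := by exact_mod_cast hi
    have main : rr ((s i).2 - a) < rr (b - a) := by
      rcases Nat.eq_zero_or_pos (κ i : ℕ) with h0 | hpos
      · have e := hκ i
        rw [h0, Nat.cast_zero] at e
        have e' : rr ((s i).1 - a) = 0 := by
          rcases mul_eq_zero.1 e with h | h
          · exact absurd h hd0.ne'
          · exact h
        rw [← rr_zero] at e'
        have e2 : (s i).1 = a := sub_eq_zero.1 (rr_inj e')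
        have : i = i0 := hdis1 _ _ (by rw [e2, hi0])
        rw [this, hi0]; exact hlt
      · have hpos' : (0:ℝ) < (κ i : ℕ) := by exact_mod_cast hpos
        have p1 : 0 < rr ((s i).1 - a) := by
          have := hκ i
          by_contra hc
          nlinarith
        have p2 : rr ((s i).1 - a) < rr (b - a) := by
          have := hκ i
          refine lt_of_mul_lt_mul_left ?_ hd0.le
          linarith
        by_contra hc
        have hc' : rr (b - a) < rr ((s i).2 - a) := by
          refine lt_of_le_of_ne (not_lt.1 hc) (fun h => h3 ?_)
          rw [rr_sub_inj h, (hs i).2.2]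
        refine Λ.pairwise_unlinked _ hab _ (hs i).1 (Or.inl ⟨sbtw_of _ _ _ p1 p2, ?_⟩)
        exact sbtw_cyclic_left (sbtw_of _ _ _ (p1.trans p2) hc')
    have m2 := mul_lt_mul_of_pos_left main hd0
    rw [hl i, hN] at m2
    have : (l i : ℝ) < N := by linarith
    exact_mod_cast this
  choose ι hι using κsurj
  let f : Fin (N+1) → Fin N := fun k => ⟨l (ι ⟨k, by omega⟩), hin _ (by rw [hι]; simp; omega)⟩
  have finj : Function.Injective f := by
    intro x y h
    have h' := linj (Fin.mk.inj_iff.1 h)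
    have := congrArg κ h'
    rw [hι, hι] at this
    exact Fin.ext (Fin.mk.inj_iff.1 this)
  have := Fintype.card_le_of_injective f finj
  simp at this

lemma key_iter (d : ℕ) (hd : 2 ≤ d) (Λ : Geolam d) (j : ℕ) (a b c : S1)
    (ha : a ∈ periodicPts (sig d)) (hb : b ∈ periodicPts (sig d)) (hc : c ∈ periodicPts (sig d))
    (hab : (a, b) ∈ Λ.leaves) (hac : (a, c) ∈ Λ.leaves)
    (h1 : a ≠ b) (h2 : a ≠ c) (hlt : rr (c - a) < rr (b - a)) :
    rr ((sig d)^[j] c - (sig d)^[j] a) < rr ((sig d)^[j] b - (sig d)^[j] a) := by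
  induction j generalizing a b c with
  | zero => simpa using hlt
  | succ j ih =>
    have inj := (bijOn_periodicPts (sig d)).injOn
    have mt := (bijOn_periodicPts (sig d)).mapsTo
    have h3 : b ≠ c := by rintro rfl; exact lt_irrefl _ hlt
    simp only [Function.iterate_succ_apply]
    exact ih _ _ _ (mt ha) (mt hb) (mt hc) (Λ.forward _ hab) (Λ.forward _ hac)
      (fun h => h1 (inj ha hb h)) (fun h => h2 (inj ha hc h))
      (key d hd Λ a b c hab hac (fun h => h1 (inj ha hb h)) (fun h => h2 (inj ha hc h))
        (fun h => h3 (inj hb hc h)) hlt)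

lemma fwd_iter (d : ℕ) (Λ : Geolam d) (j : ℕ) (a b : S1) (hab : (a, b) ∈ Λ.leaves) :
    ((sig d)^[j] a, (sig d)^[j] b) ∈ Λ.leaves := by
  induction j generalizing a b with
  | zero => simpa using hab
  | succ j ih => exact ih _ _ (Λ.forward _ hab)

lemma fix_of (d : ℕ) (hd : 2 ≤ d) (Λ : Geolam d) (a b : S1)
    (hab : (a, b) ∈ Λ.leaves) (hne : a ≠ b)
    (ha : a ∈ periodicPts (sig d)) (hb : b ∈ periodicPts (sig d))
    (n : ℕ) (hn : 0 < n) (hfix : (sig d)^[n] a = a) : (sig d)^[n] b = b := by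
  set g := (sig d)^[n] with hg
  have gP : ∀ k, g^[k] b ∈ periodicPts (sig d) := by
    intro k
    rw [hg, ← Function.iterate_mul]
    exact (bijOn_periodicPts (sig d)).mapsTo.iterate _ hb
  have ga : ∀ k, g^[k] a = a := fun k => Function.iterate_fixed hfix k
  have gL : ∀ k, (a, g^[k] b) ∈ Λ.leaves := by
    intro k
    have := fwd_iter d Λ (n * k) a b hab
    rw [Function.iterate_mul, ← hg, ga] at this
    exact this
  have gne : ∀ k, a ≠ g^[k] b := by
    intro k h
    apply hne
    have inj : Set.InjOn ((sig d)^[n * k]) (periodicPts (sig d)) :=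
      ((bijOn_periodicPts (sig d)).iterate _).injOn
    apply inj ha hb
    rw [Function.iterate_mul, ← hg, ga, ← h]
  have step : ∀ k l, rr (g^[k] b - a) < rr (g^[l] b - a) →
      rr (g^[k+1] b - a) < rr (g^[l+1] b - a) := by
    intro k l h
    have := key_iter d hd Λ n a _ _ ha (gP l) (gP k) (gL l) (gL k) (gne l) (gne k) h
    rw [← hg, hfix, ← Function.iterate_succ_apply' g, ← Function.iterate_succ_apply' g] at this
    exact this
  obtain ⟨m, hm, hmb⟩ := hb
  have per : g^[m] b = b := by
    rw [hg, ← Function.iterate_mul, mul_comm, Function.iterate_mul]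
    exact Function.iterate_fixed hmb n
  rcases lt_trichotomy (rr (b - a)) (rr (g b - a)) with h | h | h
  · have mono : StrictMono (fun k => rr (g^[k] b - a)) := by
      apply strictMono_nat_of_lt_succ
      intro k
      induction k with
      | zero => simpa using h
      | succ k ih => exact step _ _ ih
    have := mono hm
    simp [per] at this
  · exact (rr_sub_inj h).symm
  · have mono : StrictAnti (fun k => rr (g^[k] b - a)) := by
      apply strictAnti_nat_of_succ_lt
      intro k
      induction k with
      | zero => simpa using h
      | succ k ih => exact step _ _ ih
    have := mono hm
    simp [per] at this

/-- Both endpoints of a periodic leaf of a sibling σ_d-invariant geolamination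
have the same (least) period. -/
theorem stmt1 (d : ℕ) (hd : 2 ≤ d) (Λ : Geolam d) (a b : S1)
    (hab : (a, b) ∈ Λ.leaves)
    (ha : ∃ n : ℕ, 0 < n ∧ (sig d)^[n] a = a)
    (hb : ∃ m : ℕ, 0 < m ∧ (sig d)^[m] b = b) :
    Function.minimalPeriod (sig d) a = Function.minimalPeriod (sig d) b := by
  rcases eq_or_ne a b with rfl | hne
  · rfl
  have ha' : a ∈ periodicPts (sig d) := ha
  have hb' : b ∈ periodicPts (sig d) := hb
  apply Nat.dvd_antisymm
  · apply Function.IsPeriodicPt.minimalPeriod_dvd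
    exact fix_of d hd Λ b a (Λ.symm _ _ hab) hne.symm hb' ha' _
      (minimalPeriod_pos_of_mem_periodicPts hb') (isPeriodicPt_minimalPeriod _ _)
  · apply Function.IsPeriodicPt.minimalPeriod_dvd
    exact fix_of d hd Λ a b hab hne ha' hb' _
      (minimalPeriod_pos_of_mem_periodicPts ha') (isPeriodicPt_minimalPeriod _ _)
end
end

section
/- Let d ≥ 2 and σ_d(x)=d·x on ℝ/ℤ. There is no strictly monotone (in circular order) infinite sequence of distinct chords ℓ_i = x_iy_i with x_0 < y_0 ≤ y_1 ≤ y_2 ≤ ... and ... ≤ x_2 ≤ x_1 ≤ x_0 (all within the arc (x_0, x_0)) such that σ_d^k(ℓ_i) = ℓ_{i+1} for all i and some fixed k ≥ 1. Equivalently: if σ_d^k(x_i)=x_{i+1}, σ_d^k(y_i)=y_{i+1}, and the sequences x_i, y_i are monotone converging, then the limit chord is fixed by σ_d^k, which is impossible for a nondegenerate chord whose endpoints are limits of non-eventually-constant monotone sequences; hence such a configuration forces ℓ_i = ℓ_j for some i ≠ j. -/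
open Function

noncomputable section

theorem sig_iter (d k : ℕ) (z : S1) : (sig d)^[k] z = (d ^ k) • z := by
  induction k with
  | zero => simp
  | succ n ih => rw [Function.iterate_succ_apply', ih, sig, smul_smul, pow_succ']

theorem ev_const (m : ℕ) (hm : 2 ≤ m) (r : ℕ → ℝ) (L : ℝ)
    (hr : Filter.Tendsto r Filter.atTop (nhds L))
    (h : ∀ i, m • ((r i : ℝ) : S1) = ((r (i + 1) : ℝ) : S1)) :
    ∃ N, ∀ n, N ≤ n → r (n + 1) = r n := by
  have hm' : (2 : ℝ) ≤ m := by exact_mod_cast hm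
  have hz : ∀ i, ∃ a : ℤ, (a : ℝ) = r (i + 1) - m * r i := by
    intro i
    have h0 : ((r (i + 1) - m * r i : ℝ) : S1) = 0 := by
      rw [AddCircle.coe_sub, ← h i, ← nsmul_eq_mul, AddCircle.coe_nsmul, sub_self]
    obtain ⟨a, ha⟩ := (AddCircle.coe_eq_zero_iff (1 : ℝ)).1 h0
    exact ⟨a, by simpa using ha⟩
  choose a ha using hz
  have hr1 : Filter.Tendsto (fun i => r (i + 1)) Filter.atTop (nhds L) :=
    hr.comp (Filter.tendsto_add_atTop_nat 1)
  have ht : Filter.Tendsto (fun i => r (i + 1) - r i) Filter.atTop (nhds 0) := by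
    simpa using hr1.sub hr
  have hm0 : (0 : ℝ) < 1 / (2 * m) := by positivity
  obtain ⟨N, hN⟩ := (Metric.tendsto_atTop.1 ht) _ hm0
  have hb : ∀ n, N ≤ n → |r (n + 1) - r n| * (2 * m) < 1 := by
    intro n hn
    have := hN n hn
    rw [Real.dist_eq, sub_zero, lt_div_iff₀ (by positivity)] at this
    exact this
  have hstep : ∀ n, N ≤ n → r (n + 2) - r (n + 1) = m * (r (n + 1) - r n) := by
    intro n hn
    have e1 := ha n
    have e2 := ha (n + 1)
    have b1 := hb n hn
    have b2 := hb (n + 1) (by omega)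
    have hlt : |((a (n + 1) - a n : ℤ) : ℝ)| < 1 := by
      have e : ((a (n + 1) - a n : ℤ) : ℝ)
          = (r (n + 1 + 1) - r (n + 1)) - m * (r (n + 1) - r n) := by
        push_cast; rw [e1, e2]; ring
      rw [e]
      have h3 := abs_sub (r (n + 1 + 1) - r (n + 1)) (m * (r (n + 1) - r n))
      rw [abs_mul, Nat.abs_cast] at h3
      nlinarith [abs_nonneg (r (n + 1 + 1) - r (n + 1))]
    have h0 : a (n + 1) - a n = 0 := by
      rw [← Int.abs_lt_one_iff]; exact_mod_cast hlt
    have h0' : (a (n + 1) : ℝ) = a n := by exact_mod_cast (sub_eq_zero.1 h0)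
    rw [e1, e2] at h0'
    have : r (n + 2) = r (n + 1 + 1) := rfl
    linarith
  refine ⟨N, fun n hn => ?_⟩
  have hpow : ∀ j, r (n + j + 1) - r (n + j) = m ^ j * (r (n + 1) - r n) := by
    intro j
    induction j with
    | zero => simp
    | succ j ih =>
      have := hstep (n + j) (by omega)
      rw [ih] at this
      rw [show n + (j + 1) + 1 = n + j + 2 by omega, show n + (j + 1) = n + j + 1 by omega, this]
      ring
  by_contra hne
  have hpos : 0 < |r (n + 1) - r n| := abs_pos.2 (sub_ne_zero.2 hne)
  obtain ⟨j, hj⟩ := pow_unbounded_of_one_lt (1 / |r (n + 1) - r n|)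
    (show (1 : ℝ) < m by linarith)
  rw [div_lt_iff₀ hpos] at hj
  have h4 := hb (n + j) (by omega)
  rw [hpow j, abs_mul, abs_pow, Nat.abs_cast] at h4
  nlinarith

theorem lift_pt (c : ℝ) (p : S1) (hp : p ≠ (c : S1)) :
    ∃ r : ℝ, c < r ∧ r < c + 1 ∧ (r : S1) = p := by
  haveI : Fact ((0 : ℝ) < 1) := ⟨one_pos⟩
  have hm := (AddCircle.equivIco (1 : ℝ) c p).2
  have he : (((AddCircle.equivIco (1 : ℝ) c p : ℝ)) : S1) = p :=
    (AddCircle.equivIco (1 : ℝ) c).symm_apply_apply p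
  refine ⟨_, lt_of_le_of_ne hm.1 ?_, hm.2, he⟩
  intro h
  rw [← h] at he
  exact hp he.symm

theorem btw_le (c r s : ℝ) (hr : c < r) (hr' : r < c + 1) (hs : c < s) (hs' : s < c + 1)
    (h : btw (c : S1) (r : S1) (s : S1)) : r ≤ s := by
  have h' := (QuotientAddGroup.btw_coe_iff (hp' := ⟨one_pos⟩)).1 h
  rwa [(toIcoMod_eq_self _).2 ⟨hr.le, hr'⟩, (toIocMod_eq_self _).2 ⟨hs, hs'.le⟩] at h'

/-- Monotone orbits avoiding the base point are eventually constant. -/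
theorem orbit_const (m : ℕ) (hm : 2 ≤ m) (p : S1) (z : ℕ → S1)
    (hz : ∀ i, m • z i = z (i + 1)) (hp : ∀ i, z i ≠ p)
    (hmon : (∀ i, btw p (z i) (z (i + 1))) ∨ (∀ i, btw p (z (i + 1)) (z i))) :
    ∃ N, ∀ n, N ≤ n → z (n + 1) = z n := by
  obtain ⟨c, rfl⟩ := QuotientAddGroup.mk_surjective p
  choose r h1 h2 h3 using fun i => lift_pt c (z i) (hp i)
  have hL : ∃ L, Filter.Tendsto r Filter.atTop (nhds L) := by
    rcases hmon with hmon | hmon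
    · have hmo : Monotone r := monotone_nat_of_le_succ fun i =>
        btw_le c _ _ (h1 i) (h2 i) (h1 _) (h2 _) (by rw [h3, h3]; exact hmon i)
      exact ⟨_, tendsto_atTop_ciSup hmo ⟨c + 1, by rintro _ ⟨i, rfl⟩; exact (h2 i).le⟩⟩
    · have hmo : Antitone r := antitone_nat_of_succ_le fun i =>
        btw_le c _ _ (h1 _) (h2 _) (h1 i) (h2 i) (by rw [h3, h3]; exact hmon i)
      exact ⟨_, tendsto_atTop_ciInf hmo ⟨c, by rintro _ ⟨i, rfl⟩; exact (h1 i).le⟩⟩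
  obtain ⟨L, hL⟩ := hL
  obtain ⟨N, hN⟩ := ev_const m hm r L hL (fun i => by rw [h3, h3]; exact hz i)
  exact ⟨N, fun n hn => by rw [← h3, ← h3, hN n hn]⟩

theorem per_of_eq (m : ℕ) (z : ℕ → S1) (hz : ∀ i, m • z i = z (i + 1)) (a b : ℕ)
    (w : ℕ → S1) (hw : ∀ i, m • w i = w (i + 1)) (h : z a = w b) (n : ℕ) :
    z (a + n) = w (b + n) := by
  induction n with
  | zero => exact h
  | succ n ih => rw [← add_assoc, ← add_assoc, ← hz, ← hw, ih]

/-- There is no strictly monotone infinite sequence of distinct chords ℓ_i = x_i y_i with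
σ_d^k(ℓ_i) = ℓ_{i+1}, the y_i moving forward and the x_i moving backward inside the arc
cut off at x_0: such a monotone configuration forces two chords to coincide. -/
theorem stmt7 (d : ℕ) (hd : 2 ≤ d) (k : ℕ) (hk : 1 ≤ k)
    (x y : ℕ → S1)
    (hx : ∀ i : ℕ, (sig d)^[k] (x i) = x (i + 1))
    (hy : ∀ i : ℕ, (sig d)^[k] (y i) = y (i + 1))
    (hnd : x 0 ≠ y 0)
    (h1 : ∀ i : ℕ, btw (x 0) (y i) (y (i + 1)))
    (h2 : ∀ i : ℕ, btw (x (i + 1)) (x i) (x 0))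
    (h3 : ∀ i j : ℕ, btw (x 0) (y i) (x (j + 1))) :
    ∃ i j : ℕ, i ≠ j ∧ x i = x j ∧ y i = y j := by
  have hm : 2 ≤ d ^ k := le_trans hd (Nat.le_self_pow (by omega) d)
  simp only [sig_iter] at hx hy
  generalize d ^ k = m at hm hx hy
  -- `x` is eventually periodic
  have hX : ∃ N p, 1 ≤ p ∧ ∀ n, N ≤ n → x (n + p) = x n := by
    by_cases hr : ∃ p, 1 ≤ p ∧ x p = x 0
    · obtain ⟨p, hp, he⟩ := hr
      refine ⟨0, p, hp, fun n _ => ?_⟩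
      have := per_of_eq m x hx p 0 x hx he n
      rwa [zero_add, add_comm] at this
    · push Not at hr
      obtain ⟨N, hN⟩ := orbit_const m hm (x 0) (fun i => x (i + 1)) (fun i => hx (i + 1))
        (fun i => hr _ (by omega)) (Or.inr fun i => (h2 (i + 1)).cyclic_right)
      refine ⟨N + 1, 1, le_rfl, fun n hn => ?_⟩
      obtain ⟨n, rfl⟩ : ∃ n', n = n' + 1 := ⟨n - 1, by omega⟩
      exact hN n (by omega)
  obtain ⟨N, p, hp, hN⟩ := hX
  have hY : ∃ M, ∀ n, M ≤ n → y (n + p) = y n := by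
    by_cases hr : ∃ q, y q = x 0
    · obtain ⟨q, hq⟩ := hr
      refine ⟨q + N, fun n hn => ?_⟩
      obtain ⟨t, rfl⟩ : ∃ t, n = q + t := ⟨n - q, by omega⟩
      rw [add_assoc, per_of_eq m y hy q 0 x hx hq, per_of_eq m y hy q 0 x hx hq, zero_add,
        zero_add]
      exact hN t (by omega)
    · push Not at hr
      obtain ⟨M, hM⟩ := orbit_const m hm (x 0) y hy hr (Or.inl h1)
      refine ⟨M, fun n hn => ?_⟩
      clear hp hN
      induction p with
      | zero => rfl
      | succ p ih => rw [← add_assoc, hM _ (by omega), ih]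
  obtain ⟨M, hM⟩ := hY
  exact ⟨N + M + p, N + M, by omega, hN _ (by omega), hM _ (by omega)⟩
end
end
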